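/- arXiv:math/0209384 — 2 statements merged into one kernel-verified Lean document; each statement's English description precedes it below -/
import Mathlib

section
/- Let m ≥ 2, σ > 1, H > 0, and let Q : (0,∞) → ℝ be a positive non-decreasing function with Q(t) = o(t²) as t → +∞ and liminf_{r→+∞} Q(r)·(log r)/r² < +∞. Let a, b : ℝ^m → ℝ be continuous functions such that b(x) ≥ 1/Q(|x|) for |x| > 0, the negative part a_-(x) = max(−a(x), 0) is bounded on ℝ^m, and a_-(x)/b(x) ≤ H for all x ∈ ℝ^m. If u ∈ C²(ℝ^m) is a non-negative function satisfying Δu(x) ≥ b(x) u(x)^σ + a(x) u(x) for all x ∈ ℝ^m, then u(x) ≤ H^{1/(σ−1)} for all x ∈ ℝ^m. -/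
open Filter Asymptotics

/-- The Laplacian on Euclidean space: the sum of the pure second partial derivatives. -/
noncomputable def euclideanLaplacian {m : ℕ} (u : EuclideanSpace ℝ (Fin m) → ℝ)
    (x : EuclideanSpace ℝ (Fin m)) : ℝ :=
  ∑ i, fderiv ℝ (fun y => fderiv ℝ u y (EuclideanSpace.single i 1)) x (EuclideanSpace.single i 1)

/-- Second-derivative test: at a local maximum the second derivative is nonpositive. -/
theorem IsLocalMax.second_deriv_nonpos {f f' : ℝ → ℝ} {x d : ℝ} (hmax : IsLocalMax f x)
    (hf : ∀ᶠ t in nhds x, HasDerivAt f (f' t) t) (hf' : HasDerivAt f' d x) : d ≤ 0 := by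
  by_contra! hd
  let g : ℝ → ℝ := fun t => f t - d / 4 * (t - x) ^ 2
  have hg : ∀ᶠ t in nhds x, HasDerivAt g (f' t - d / 2 * (t - x)) t := by
    filter_upwards [hf] with t ht
    have h := ht.sub ((((hasDerivAt_id t).sub_const x).pow 2).const_mul (d / 4))
    refine h.congr_deriv ?_
    simp
    ring
  have hdg : deriv g =ᶠ[nhds x] fun t => f' t - d / 2 * (t - x) := hg.mono fun t ht => ht.deriv
  have hg2 : HasDerivAt (fun t => f' t - d / 2 * (t - x)) (d / 2) x := by
    have h := hf'.sub (((hasDerivAt_id x).sub_const x).const_mul (d / 2))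
    refine h.congr_deriv ?_
    ring
  have hmin : IsLocalMin g x := by
    apply isLocalMin_of_deriv_deriv_pos
    · rw [hdg.deriv_eq, hg2.deriv]; positivity
    · rw [hdg.eq_of_nhds, (hmax.hasDerivAt_eq_zero hf.self_of_nhds)]; simp
    · exact hg.self_of_nhds.continuousAt
  have hev : ∀ᶠ t in nhds x, t = x := by
    filter_upwards [hmax, hmin] with t h1 h2
    simp only [g, sub_self] at h2
    have h3 : (t - x) ^ 2 ≤ 0 := by
      by_contra! h
      nlinarith [mul_pos hd h]
    nlinarith [pow_eq_zero_iff (two_ne_zero) |>.mp (le_antisymm h3 (sq_nonneg _))]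
  have hne : ∃ᶠ t in nhds x, t ≠ x :=
    (eventually_mem_nhdsWithin (a := x) (s := {x}ᶜ)).frequently.filter_mono nhdsWithin_le_nhds
  exact hne (hev.mono fun t ht h => h ht)

/-- First and second derivatives of `t ↦ (1 - (s + 2 c t + t²) / r)⁻¹ ^ (k + 1)`. -/
theorem hasDerivAt_radial_barrier (s c r : ℝ) (k : ℕ) {t : ℝ}
    (ht : 1 - (s + 2 * c * t + t ^ 2) / r ≠ 0) :
    HasDerivAt (fun t => (1 - (s + 2 * c * t + t ^ 2) / r)⁻¹ ^ (k + 1))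
      ((k + 1) * (1 - (s + 2 * c * t + t ^ 2) / r)⁻¹ ^ (k + 2) * ((2 * c + 2 * t) / r)) t := by
  have hq : HasDerivAt (fun t => 1 - (s + 2 * c * t + t ^ 2) / r) (-((2 * c + 2 * t) / r)) t := by
    have h := (((((hasDerivAt_id t).const_mul (2 * c)).const_add s).add
      ((hasDerivAt_id t).pow 2)).div_const r).const_sub 1
    refine h.congr_deriv ?_
    simp
  have h := (hq.inv ht).pow (k + 1)
  refine h.congr_deriv ?_
  simp only [Pi.inv_apply, Nat.add_sub_cancel, neg_neg]
  rw [div_eq_mul_inv _ (_ ^ 2), ← inv_pow]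
  push_cast
  ring

theorem hasDerivAt_deriv_radial_barrier (s c r : ℝ) (k : ℕ) (h0 : 1 - s / r ≠ 0) :
    HasDerivAt (fun t => (k + 1) * (1 - (s + 2 * c * t + t ^ 2) / r)⁻¹ ^ (k + 2) *
        ((2 * c + 2 * t) / r))
      ((k + 1) * (k + 2) * (1 - s / r)⁻¹ ^ (k + 3) * (4 * c ^ 2 / r ^ 2) +
        (k + 1) * (1 - s / r)⁻¹ ^ (k + 2) * (2 / r)) 0 := by
  have h0' : 1 - (s + 2 * c * 0 + 0 ^ 2) / r ≠ 0 := by simpa using h0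
  have h1 := (hasDerivAt_radial_barrier s c r (k + 1) h0').const_mul ((k : ℝ) + 1)
  have h2 : HasDerivAt (fun t : ℝ => (2 * c + 2 * t) / r) (2 / r) 0 := by
    have h := (((hasDerivAt_id (0 : ℝ)).const_mul 2).const_add (2 * c)).div_const r
    refine h.congr_deriv ?_
    simp
  have h := h1.mul h2
  refine h.congr_deriv ?_
  push_cast
  simp only [mul_zero, add_zero, ne_eq, OfNat.ofNat_ne_zero, not_false_eq_true, zero_pow]
  ring

/-- If `u - M (1 - |x|²/r)^{-(k+1)}` has a local maximum at `y`, then `Δu(y)` is bounded by the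
Laplacian of the barrier. -/
theorem euclideanLaplacian_le_of_isLocalMax {m : ℕ} {u : EuclideanSpace ℝ (Fin m) → ℝ}
    (hu : ContDiff ℝ 2 u) {y : EuclideanSpace ℝ (Fin m)} {M r : ℝ} {k : ℕ}
    (hy : 1 - ‖y‖ ^ 2 / r ≠ 0)
    (hmax : IsLocalMax (fun x => u x - M * (1 - ‖x‖ ^ 2 / r)⁻¹ ^ (k + 1)) y) :
    euclideanLaplacian u y ≤
      M * ((k + 1) * (k + 2) * (1 - ‖y‖ ^ 2 / r)⁻¹ ^ (k + 3) * (4 * ‖y‖ ^ 2 / r ^ 2) +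
        m * ((k + 1) * (1 - ‖y‖ ^ 2 / r)⁻¹ ^ (k + 2) * (2 / r))) := by
  have hnorm : ∀ (i : Fin m) (t : ℝ), ‖y + t • EuclideanSpace.single i (1 : ℝ)‖ ^ 2 =
      ‖y‖ ^ 2 + 2 * y i * t + t ^ 2 := by
    intro i t
    rw [norm_add_sq_real, norm_smul, inner_smul_right, EuclideanSpace.inner_single_right]
    simp
    ring
  have key : ∀ i : Fin m,
      fderiv ℝ (fun z => fderiv ℝ u z (EuclideanSpace.single i 1)) y (EuclideanSpace.single i 1) ≤
      M * ((k + 1) * (k + 2) * (1 - ‖y‖ ^ 2 / r)⁻¹ ^ (k + 3) * (4 * (y i) ^ 2 / r ^ 2) +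
        (k + 1) * (1 - ‖y‖ ^ 2 / r)⁻¹ ^ (k + 2) * (2 / r)) := by
    intro i
    let e : EuclideanSpace ℝ (Fin m) := EuclideanSpace.single i 1
    have hline : ∀ t : ℝ, HasDerivAt (fun t : ℝ => y + t • e) e t := by
      intro t
      simpa using ((hasDerivAt_id t).smul_const e).const_add y
    have hl0 : y + (0 : ℝ) • e = y := by simp
    have hu1 : ∀ t : ℝ, HasDerivAt (fun t : ℝ => u (y + t • e)) (fderiv ℝ u (y + t • e) e) t :=
      fun t => ((hu.differentiable (by norm_num)) _).hasFDerivAt.comp_hasDerivAt t (hline t)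
    have hfd : ContDiff ℝ 1 (fun z => fderiv ℝ u z e) :=
      (hu.fderiv_right (m := 1) (by norm_num)).clm_apply contDiff_const
    have hu2 : HasDerivAt (fun t : ℝ => fderiv ℝ u (y + t • e) e)
        (fderiv ℝ (fun z => fderiv ℝ u z e) y e) 0 := by
      have h := ((hfd.differentiable (by norm_num)) (y + (0 : ℝ) • e)).hasFDerivAt.comp_hasDerivAt
        (0 : ℝ) (hline 0)
      rw [hl0] at h
      exact h
    have hmax' : IsLocalMax (fun t : ℝ => u (y + t • e) -
        M * (1 - (‖y‖ ^ 2 + 2 * y i * t + t ^ 2) / r)⁻¹ ^ (k + 1)) 0 := by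
      have hc : Tendsto (fun t : ℝ => y + t • e) (nhds 0) (nhds y) := by
        have h := (hline 0).continuousAt.tendsto
        rwa [hl0] at h
      have h := hc.eventually hmax
      filter_upwards [h] with t ht
      rw [hnorm i t] at ht
      simpa using ht
    have hne : ∀ᶠ t : ℝ in nhds 0, 1 - (‖y‖ ^ 2 + 2 * y i * t + t ^ 2) / r ≠ 0 := by
      have hc : Continuous fun t : ℝ => 1 - (‖y‖ ^ 2 + 2 * y i * t + t ^ 2) / r := by fun_prop
      exact hc.continuousAt.eventually_ne (by simpa using hy)
    have hder : ∀ᶠ t : ℝ in nhds 0, HasDerivAt (fun t : ℝ => u (y + t • e) -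
        M * (1 - (‖y‖ ^ 2 + 2 * y i * t + t ^ 2) / r)⁻¹ ^ (k + 1))
        (fderiv ℝ u (y + t • e) e - M * ((k + 1) *
          (1 - (‖y‖ ^ 2 + 2 * y i * t + t ^ 2) / r)⁻¹ ^ (k + 2) * ((2 * y i + 2 * t) / r))) t := by
      filter_upwards [hne] with t ht
      exact (hu1 t).sub ((hasDerivAt_radial_barrier _ _ r k ht).const_mul M)
    have := hmax'.second_deriv_nonpos hder
      (hu2.sub ((hasDerivAt_deriv_radial_barrier _ _ r k hy).const_mul M))
    linarith
  calc euclideanLaplacian u y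
      ≤ ∑ i : Fin m, M * ((k + 1) * (k + 2) * (1 - ‖y‖ ^ 2 / r)⁻¹ ^ (k + 3) *
          (4 * (y i) ^ 2 / r ^ 2) + (k + 1) * (1 - ‖y‖ ^ 2 / r)⁻¹ ^ (k + 2) * (2 / r)) :=
        Finset.sum_le_sum fun i _ => key i
    _ = _ := by
        have hs : ‖y‖ ^ 2 = ∑ i, (y i) ^ 2 := EuclideanSpace.real_norm_sq_eq y
        rw [← Finset.mul_sum, Finset.sum_add_distrib, ← Finset.mul_sum, ← Finset.sum_div,
          ← Finset.mul_sum, ← hs]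
        simp

/-- Keller–Osserman type estimate on the ball of radius `R`. -/
theorem sub_mul_pow_le_of_le_euclideanLaplacian {m : ℕ} {u : EuclideanSpace ℝ (Fin m) → ℝ}
    (hu : ContDiff ℝ 2 u) {h ε τ κ R : ℝ} {k : ℕ} (hε : 0 < ε) (hτ : 0 < τ) (hκ : 0 < κ)
    (hR : 0 < R) (hk : 2 ≤ (k + 1) * τ)
    (hΔ : ∀ x, ‖x‖ < R → h + ε < u x →
      κ * (u x - h) * (u x - h) ^ τ ≤ euclideanLaplacian u x)
    (hκR : (4 * (k + 1) * (k + 2) + 2 * m * (k + 1)) / R ^ 2 < κ * ε ^ τ)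
    {x : EuclideanSpace ℝ (Fin m)} (hx : ‖x‖ ≤ R) :
    (u x - h) * (1 - ‖x‖ ^ 2 / R ^ 2) ^ (k + 1) ≤ ε := by
  let F : EuclideanSpace ℝ (Fin m) → ℝ := fun x => (u x - h) * (1 - ‖x‖ ^ 2 / R ^ 2) ^ (k + 1)
  have huc := hu.continuous
  have hF : Continuous F := by fun_prop
  obtain ⟨y, hyB, hymax⟩ := (isCompact_closedBall (0 : EuclideanSpace ℝ (Fin m)) R).exists_isMaxOn
    ⟨x, by simpa using hx⟩ hF.continuousOn
  by_contra! hcon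
  have hM : ε < F y := hcon.trans_le (hymax (by simpa using hx))
  have hyR : ‖y‖ ≤ R := by simpa using hyB
  have hyR' : ‖y‖ < R := by
    refine lt_of_le_of_ne hyR fun heq => ?_
    have : F y = 0 := by simp [F, heq, hR.ne']
    linarith
  have hηpos : ∀ z : EuclideanSpace ℝ (Fin m), ‖z‖ < R → 0 < 1 - ‖z‖ ^ 2 / R ^ 2 := by
    intro z hz
    rw [sub_pos, div_lt_one (by positivity)]
    gcongr
  set M := F y with hMdef
  have hMpos : 0 < M := hε.trans hM
  have hmax : IsLocalMax (fun x => u x - M * (1 - ‖x‖ ^ 2 / R ^ 2)⁻¹ ^ (k + 1)) y := by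
    have hball : Metric.ball (0 : EuclideanSpace ℝ (Fin m)) R ∈ nhds y :=
      Metric.isOpen_ball.mem_nhds (by simpa using hyR')
    have hyeq : u y - h = M * (1 - ‖y‖ ^ 2 / R ^ 2)⁻¹ ^ (k + 1) := by
      rw [inv_pow, ← div_eq_mul_inv, eq_div_iff (pow_pos (hηpos y hyR') _).ne']
    filter_upwards [hball] with z hz
    have hzR : ‖z‖ < R := by simpa using hz
    have hzle : u z - h ≤ M * (1 - ‖z‖ ^ 2 / R ^ 2)⁻¹ ^ (k + 1) := by
      rw [inv_pow, ← div_eq_mul_inv, le_div_iff₀ (pow_pos (hηpos z hzR) _)]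
      exact hymax (by simpa using hzR.le)
    linarith
  have hη := hηpos y hyR'
  have hup := euclideanLaplacian_le_of_isLocalMax hu hη.ne' hmax
  set P := (1 - ‖y‖ ^ 2 / R ^ 2)⁻¹ with hP
  have hyeq : u y - h = M * P ^ (k + 1) := by
    rw [hP, inv_pow, ← div_eq_mul_inv, eq_div_iff (pow_pos hη _).ne']
  have hP1 : 1 ≤ P := by
    apply (one_le_inv₀ hη).2
    have : 0 ≤ ‖y‖ ^ 2 / R ^ 2 := by positivity
    linarith
  have hPk : 1 ≤ P ^ (k + 1) := one_le_pow₀ hP1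
  have hlow := hΔ y hyR' (by nlinarith)
  rw [hyeq] at hlow
  have hpow : ε ^ τ * P ^ 2 ≤ (M * P ^ (k + 1)) ^ τ := by
    rw [Real.mul_rpow hMpos.le (by positivity)]
    gcongr
    rw [← Real.rpow_natCast P (k + 1), ← Real.rpow_mul (by positivity), ← Real.rpow_natCast P 2]
    exact Real.rpow_le_rpow_of_exponent_le hP1 (by push_cast; exact hk)
  have hs : 4 * ‖y‖ ^ 2 / (R ^ 2) ^ 2 ≤ 4 / R ^ 2 := by
    rw [div_le_div_iff₀ (by positivity) (by positivity)]
    have : ‖y‖ ^ 2 ≤ R ^ 2 := by gcongr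
    nlinarith [mul_le_mul_of_nonneg_left this (sq_nonneg R)]
  have hup' : euclideanLaplacian u y ≤
      M * P ^ (k + 3) * ((4 * (k + 1) * (k + 2) + 2 * m * (k + 1)) / R ^ 2) := by
    refine hup.trans ?_
    have h1 : ((k : ℝ) + 1) * (k + 2) * P ^ (k + 3) * (4 * ‖y‖ ^ 2 / (R ^ 2) ^ 2) ≤
        (k + 1) * (k + 2) * P ^ (k + 3) * (4 / R ^ 2) := by gcongr
    have h2 : (m : ℝ) * ((k + 1) * P ^ (k + 2) * (2 / R ^ 2)) ≤
        m * ((k + 1) * P ^ (k + 3) * (2 / R ^ 2)) := by gcongr; simp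
    calc _ ≤ M * (((k : ℝ) + 1) * (k + 2) * P ^ (k + 3) * (4 / R ^ 2) +
          m * ((k + 1) * P ^ (k + 3) * (2 / R ^ 2))) := by gcongr
      _ = _ := by ring
  have hlow' : M * P ^ (k + 3) * (κ * ε ^ τ) ≤ euclideanLaplacian u y := by
    calc M * P ^ (k + 3) * (κ * ε ^ τ) = κ * (M * P ^ (k + 1)) * (ε ^ τ * P ^ 2) := by ring
      _ ≤ κ * (M * P ^ (k + 1)) * (M * P ^ (k + 1)) ^ τ := by gcongr
      _ ≤ _ := hlow
  have hpos : 0 < M * P ^ (k + 3) := by positivity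
  exact absurd (le_of_mul_le_mul_left (hlow'.trans hup') hpos) (not_le.2 hκR)

/-- For `v = t - h > ε`, the nonlinearity `t (t ^ τ - h ^ τ)` dominates a multiple of `v ^ (τ+1)`. -/
theorem rpow_gap_lower_bound {h ε τ t : ℝ} (hh : 0 < h) (hε : 0 < ε) (hτ : 0 < τ)
    (ht : h + ε < t) :
    (1 - (h / (h + ε)) ^ τ) * (t - h) * (t - h) ^ τ ≤ t * (t ^ τ - h ^ τ) := by
  have htp : 0 < t := by linarith
  have hv : 0 < t - h := by linarith
  have hc : 0 ≤ 1 - (h / (h + ε)) ^ τ := by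
    rw [sub_nonneg]
    exact Real.rpow_le_one (by positivity) ((div_le_one (by positivity)).2 (by linarith)) hτ.le
  have hge : (1 - (h / (h + ε)) ^ τ) * t ^ τ ≤ t ^ τ - h ^ τ := by
    have h1 : h ^ τ = (h / t) ^ τ * t ^ τ := by
      rw [← Real.mul_rpow (by positivity) htp.le, div_mul_cancel₀ _ htp.ne']
    have h2 : (h / t) ^ τ ≤ (h / (h + ε)) ^ τ := by gcongr
    have h3 : 0 < t ^ τ := by positivity
    rw [h1]
    nlinarith
  calc (1 - (h / (h + ε)) ^ τ) * (t - h) * (t - h) ^ τ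
      ≤ (1 - (h / (h + ε)) ^ τ) * t * t ^ τ := by gcongr <;> linarith
    _ = t * ((1 - (h / (h + ε)) ^ τ) * t ^ τ) := by ring
    _ ≤ _ := by gcongr

theorem stmt6 {m : ℕ} (hm : 2 ≤ m) (σ H : ℝ) (hσ : 1 < σ) (hH : 0 < H)
    (Q : ℝ → ℝ)
    (hQpos : ∀ t > (0:ℝ), 0 < Q t)
    (hQmono : ∀ s t : ℝ, 0 < s → s ≤ t → Q s ≤ Q t)
    (hQo : Q =o[atTop] fun t => t ^ 2)
    (hliminf : ∃ C : ℝ, ∃ᶠ r in atTop, Q r * Real.log r / r ^ 2 ≤ C)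
    (a b : EuclideanSpace ℝ (Fin m) → ℝ) (ha : Continuous a) (hb : Continuous b)
    (hbQ : ∀ x : EuclideanSpace ℝ (Fin m), 0 < ‖x‖ → 1 / Q ‖x‖ ≤ b x)
    (haminus : ∃ C : ℝ, ∀ x, max (-a x) 0 ≤ C)
    (haH : ∀ x, max (-a x) 0 / b x ≤ H)
    (u : EuclideanSpace ℝ (Fin m) → ℝ) (hu : ContDiff ℝ 2 u)
    (hupos : ∀ x, 0 ≤ u x)
    (hineq : ∀ x, b x * u x ^ σ + a x * u x ≤ euclideanLaplacian u x) :
    ∀ x, u x ≤ H ^ (1 / (σ - 1)) := by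
  have : Nonempty (Fin m) := ⟨⟨0, by omega⟩⟩
  set h := H ^ (1 / (σ - 1)) with hhdef
  have hτ : 0 < σ - 1 := by linarith
  have hh : 0 < h := by positivity
  have hhH : h ^ (σ - 1) = H := by
    rw [hhdef, ← Real.rpow_mul hH.le, one_div_mul_cancel hτ.ne', Real.rpow_one]
  have hbR : ∀ R > (0 : ℝ), ∀ x : EuclideanSpace ℝ (Fin m), ‖x‖ < R → 1 / Q R ≤ b x := by
    intro R hR
    have hne : ∀ x : EuclideanSpace ℝ (Fin m), x ≠ 0 → ‖x‖ < R → 1 / Q R ≤ b x := by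
      intro x hx0 hxR
      have hx : 0 < ‖x‖ := norm_pos_iff.2 hx0
      exact (one_div_le_one_div_of_le (hQpos _ hx) (hQmono _ _ hx hxR.le)).trans (hbQ x hx)
    intro x hx
    rcases eq_or_ne x 0 with rfl | hx0
    · have hlim : Tendsto b (nhdsWithin 0 {0}ᶜ) (nhds (b 0)) :=
        hb.continuousAt.tendsto.mono_left nhdsWithin_le_nhds
      refine ge_of_tendsto hlim ?_
      filter_upwards [self_mem_nhdsWithin,
        nhdsWithin_le_nhds (Metric.ball_mem_nhds (0 : EuclideanSpace ℝ (Fin m)) hR)] with z hz hzR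
      exact hne z hz (by simpa using hzR)
    · exact hne x hx0 hx
  intro x
  refine le_of_forall_pos_le_add fun ε hε => ?_
  obtain ⟨k, hk⟩ := exists_nat_ge (2 / (σ - 1))
  have hk' : 2 ≤ ((k : ℝ) + 1) * (σ - 1) := by
    rw [div_le_iff₀ hτ] at hk
    nlinarith
  set c := 1 - (h / (h + ε)) ^ (σ - 1) with hc
  have hcpos : 0 < c := by
    rw [hc, sub_pos]
    exact Real.rpow_lt_one (by positivity) ((div_lt_one (by positivity)).2 (by linarith)) hτ
  have hΔ : ∀ R > (0 : ℝ), ∀ y, ‖y‖ < R → h + ε < u y →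
      c / Q R * (u y - h) * (u y - h) ^ (σ - 1) ≤ euclideanLaplacian u y := by
    intro R hR y hyR hy
    have hb1 := hbR R hR y hyR
    have hQR := hQpos R hR
    have hbpos : 0 < b y := lt_of_lt_of_le (by positivity) hb1
    have huy : 0 < u y := by linarith
    have hau : -(H * b y) ≤ a y := by
      have h1 := (div_le_iff₀ hbpos).1 (haH y)
      linarith [le_max_left (-a y) 0]
    have hgap := rpow_gap_lower_bound hh hε hτ hy
    rw [hhH] at hgap
    have hv : 0 < u y - h := by linarith
    have hrp : u y ^ σ = u y * u y ^ (σ - 1) := by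
      rw [Real.rpow_sub_one huy.ne']
      field_simp
    have hpos : 0 ≤ c * (u y - h) * (u y - h) ^ (σ - 1) := by positivity
    calc c / Q R * (u y - h) * (u y - h) ^ (σ - 1)
        = 1 / Q R * (c * (u y - h) * (u y - h) ^ (σ - 1)) := by ring
      _ ≤ b y * (c * (u y - h) * (u y - h) ^ (σ - 1)) := by gcongr
      _ ≤ b y * (u y * (u y ^ (σ - 1) - H)) := by gcongr
      _ = b y * u y ^ σ + -(H * b y) * u y := by rw [hrp]; ring
      _ ≤ b y * u y ^ σ + a y * u y := by gcongr
      _ ≤ _ := hineq y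
  set K : ℝ := 4 * (k + 1) * (k + 2) + 2 * m * (k + 1) with hK
  have hKpos : 0 < K := by positivity
  have hest : ∀ᶠ R : ℝ in atTop, (u x - h) * (1 - ‖x‖ ^ 2 / R ^ 2) ^ (k + 1) ≤ ε := by
    have hδ : 0 < c * ε ^ (σ - 1) / (2 * K) := by positivity
    filter_upwards [hQo.bound hδ, eventually_gt_atTop 0, eventually_ge_atTop ‖x‖] with R hQR hR hxR
    have hQp := hQpos R hR
    refine sub_mul_pow_le_of_le_euclideanLaplacian hu hε hτ (div_pos hcpos hQp) hR hk' (hΔ R hR) ?_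
      hxR
    rw [Real.norm_of_nonneg hQp.le, Real.norm_of_nonneg (sq_nonneg R)] at hQR
    rw [← hK, div_mul_eq_mul_div, div_lt_div_iff₀ (by positivity) hQp]
    have hp : 0 < c * ε ^ (σ - 1) * R ^ 2 := by positivity
    calc K * Q R ≤ K * (c * ε ^ (σ - 1) / (2 * K) * R ^ 2) := by gcongr
      _ = c * ε ^ (σ - 1) * R ^ 2 / 2 := by field_simp
      _ < _ := by linarith
  have hlim : Tendsto (fun R : ℝ => (u x - h) * (1 - ‖x‖ ^ 2 / R ^ 2) ^ (k + 1)) atTop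
      (nhds ((u x - h) * (1 - 0) ^ (k + 1))) :=
    (((tendsto_const_nhds.div_atTop (tendsto_pow_atTop two_ne_zero)).const_sub 1).pow _).const_mul _
  have := le_of_tendsto hlim hest
  simp only [sub_zero, one_pow, mul_one] at this
  linarith
end

section
/- Let m ≥ 2 and let φ ∈ C¹((0,∞)) ∩ C⁰([0,∞)) satisfy φ(0) = 0, φ(t) > 0 for all t > 0, and φ(t) ≤ A t^δ for all t ≥ 0, for some positive constants A and δ. Let σ > max{1, δ}, H > 0, and let Q : (0,∞) → ℝ be positive, non-decreasing, with Q(t) = o(t^{1+δ}) as t → +∞ and liminf_{r→+∞} Q(r)·(log r)/r^{1+δ} < +∞. Let a, b : ℝ^m → ℝ be continuous with b(x) ≥ 1/Q(|x|) for |x| > 0, a_-(x) = max(−a(x), 0) bounded on ℝ^m, and a_-(x)/b(x) ≤ H on ℝ^m. Suppose u ∈ C¹(ℝ^m) is non-negative, the vector field X : ℝ^m → ℝ^m defined by X(x) = φ(|∇u(x)|)·∇u(x)/|∇u(x)| when ∇u(x) ≠ 0 and X(x) = 0 when ∇u(x) = 0 is of class C¹, and div X (x) ≥ b(x) u(x)^σ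 + a(x) u(x) for all x ∈ ℝ^m. Then u(x) ≤ H^{1/(σ−1)} for all x ∈ ℝ^m. -/
open Filter Asymptotics Classical

/-- The divergence of a vector field on Euclidean space. -/
noncomputable def euclideanDiv {m : ℕ}
    (X : EuclideanSpace ℝ (Fin m) → EuclideanSpace ℝ (Fin m))
    (x : EuclideanSpace ℝ (Fin m)) : ℝ :=
  ∑ i, fderiv ℝ (fun y => X y i) x (EuclideanSpace.single i 1)


open MeasureTheory Topology

/-- The truncated power `max t 0 ^ p`, for `1 < p`, is differentiable everywhere. -/
theorem hasDerivAt_max_zero_rpow {p : ℝ} (hp : 1 < p) (t : ℝ) :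
    HasDerivAt (fun t : ℝ => max t 0 ^ p) (p * max t 0 ^ (p - 1)) t := by
  have h0 : (0 : ℝ) ^ p = 0 := Real.zero_rpow (by linarith)
  have h0' : (0 : ℝ) ^ (p - 1) = 0 := Real.zero_rpow (by linarith)
  have hright : ∀ t : ℝ, 0 ≤ t →
      HasDerivWithinAt (fun t : ℝ => max t 0 ^ p) (p * max t 0 ^ (p - 1)) (Set.Ici 0) t := by
    intro t ht
    rw [max_eq_left ht]
    refine (Real.hasDerivAt_rpow_const (Or.inr hp.le)).hasDerivWithinAt.congr ?_ ?_
    · intro s hs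
      simp only [max_eq_left (Set.mem_Ici.mp hs)]
    · simp only [max_eq_left ht]
  have hleft : ∀ t : ℝ, t ≤ 0 →
      HasDerivWithinAt (fun t : ℝ => max t 0 ^ p) (p * max t 0 ^ (p - 1)) (Set.Iic 0) t := by
    intro t ht
    rw [max_eq_right ht, h0', mul_zero]
    refine (hasDerivWithinAt_const t _ (0 : ℝ)).congr ?_ ?_
    · intro s hs
      simp only [max_eq_right (Set.mem_Iic.mp hs), h0]
    · simp only [max_eq_right ht, h0]
  rcases lt_trichotomy t 0 with ht | rfl | ht
  · exact (hleft t ht.le).hasDerivAt (Iic_mem_nhds ht)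
  · have := (hright 0 le_rfl).union (hleft 0 le_rfl)
    rwa [Set.union_comm, Set.Iic_union_Ici, hasDerivWithinAt_univ] at this
  · exact (hright t ht.le).hasDerivAt (Ici_mem_nhds ht)

theorem contDiff_max_zero_rpow {p : ℝ} (hp : 1 < p) :
    ContDiff ℝ 1 (fun t : ℝ => max t 0 ^ p) := by
  rw [contDiff_one_iff_deriv]
  refine ⟨fun t => (hasDerivAt_max_zero_rpow hp t).differentiableAt, ?_⟩
  have : deriv (fun t : ℝ => max t 0 ^ p) = fun t => p * max t 0 ^ (p - 1) :=
    funext fun t => (hasDerivAt_max_zero_rpow hp t).deriv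
  rw [this]
  exact continuous_const.mul
    ((continuous_id.max continuous_const).rpow_const fun _ => Or.inr (by linarith))

section Divergence

variable {m : ℕ}

theorem continuous_euclideanDiv {W : EuclideanSpace ℝ (Fin m) → EuclideanSpace ℝ (Fin m)}
    (hW : ContDiff ℝ 1 W) : Continuous (euclideanDiv W) := by
  unfold euclideanDiv
  refine continuous_finsetSum _ fun i _ => ?_
  have hWi : ContDiff ℝ 1 fun y => W y i := (contDiff_piLp_apply 2).comp hW
  exact (hWi.continuous_fderiv one_ne_zero).clm_apply continuous_const

theorem hasCompactSupport_coord_fderiv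
    {W : EuclideanSpace ℝ (Fin m) → EuclideanSpace ℝ (Fin m)} (hc : HasCompactSupport W)
    (i : Fin m) (v : EuclideanSpace ℝ (Fin m)) :
    HasCompactSupport fun x => fderiv ℝ (fun y => W y i) x v := by
  have hci : HasCompactSupport fun y => W y i :=
    hc.comp_left (g := fun z : EuclideanSpace ℝ (Fin m) => z i) rfl
  exact (hci.fderiv ℝ).comp_left (g := fun l : EuclideanSpace ℝ (Fin m) →L[ℝ] ℝ => l v) rfl

theorem integrable_euclideanDiv {W : EuclideanSpace ℝ (Fin m) → EuclideanSpace ℝ (Fin m)}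
    (hW : ContDiff ℝ 1 W) (hc : HasCompactSupport W) : Integrable (euclideanDiv W) := by
  unfold euclideanDiv
  refine integrable_finsetSum _ fun i _ => ?_
  have hWi : ContDiff ℝ 1 fun y => W y i := (contDiff_piLp_apply 2).comp hW
  exact ((hWi.continuous_fderiv one_ne_zero).clm_apply
    continuous_const).integrable_of_hasCompactSupport (hasCompactSupport_coord_fderiv hc i _)

/-- The divergence of a compactly supported `C¹` vector field integrates to zero. -/
theorem integral_euclideanDiv_eq_zero
    {W : EuclideanSpace ℝ (Fin m) → EuclideanSpace ℝ (Fin m)}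
    (hW : ContDiff ℝ 1 W) (hc : HasCompactSupport W) : ∫ x, euclideanDiv W x = 0 := by
  have hWi : ∀ i, ContDiff ℝ 1 fun y => W y i := fun i => (contDiff_piLp_apply 2).comp hW
  have hint : ∀ i, Integrable fun x =>
      fderiv ℝ (fun y => W y i) x (EuclideanSpace.single i 1) := fun i =>
    (((hWi i).continuous_fderiv one_ne_zero).clm_apply
      continuous_const).integrable_of_hasCompactSupport (hasCompactSupport_coord_fderiv hc i _)
  unfold euclideanDiv
  rw [integral_finsetSum _ fun i _ => hint i]
  refine Finset.sum_eq_zero fun i _ => ?_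
  have hci : HasCompactSupport fun y => W y i :=
    hc.comp_left (g := fun z : EuclideanSpace ℝ (Fin m) => z i) rfl
  have key := integral_mul_fderiv_eq_neg_fderiv_mul_of_integrable (𝕜 := ℝ)
    (μ := (volume : Measure (EuclideanSpace ℝ (Fin m))))
    (f := fun _ => (1 : ℝ)) (g := fun y => W y i) (v := EuclideanSpace.single i 1)
    (by simp) (by simpa using hint i)
    (by simpa using (hWi i).continuous.integrable_of_hasCompactSupport hci)
    (fun x _ => differentiableAt_const _)
    (fun x _ => (hWi i).differentiable one_ne_zero x)
  simpa using key

theorem euclideanDiv_smul {h : EuclideanSpace ℝ (Fin m) → ℝ}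
    {X : EuclideanSpace ℝ (Fin m) → EuclideanSpace ℝ (Fin m)} {x : EuclideanSpace ℝ (Fin m)}
    (hh : DifferentiableAt ℝ h x) (hX : DifferentiableAt ℝ X x) :
    euclideanDiv (fun y => h y • X y) x = h x * euclideanDiv X x + fderiv ℝ h x (X x) := by
  have hXi : ∀ i, DifferentiableAt ℝ (fun y => X y i) x := fun i =>
    (((contDiff_piLp_apply (𝕜 := ℝ) (n := 1) (i := i) 2).differentiable one_ne_zero)
      (X x)).comp x hX
  have hsum : X x = ∑ i, X x i • EuclideanSpace.single i (1 : ℝ) := by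
    have := (EuclideanSpace.basisFun (Fin m) ℝ).sum_repr (X x)
    simpa using this.symm
  have hf : fderiv ℝ h x (X x)
      = ∑ i, X x i * fderiv ℝ h x (EuclideanSpace.single i (1 : ℝ)) := by
    conv_lhs => rw [hsum]
    simp only [map_sum, map_smul, smul_eq_mul]
  rw [hf]
  unfold euclideanDiv
  rw [Finset.mul_sum, ← Finset.sum_add_distrib]
  refine Finset.sum_congr rfl fun i _ => ?_
  have : (fun y => (h y • X y) i) = fun y => h y * X y i := by
    funext y; simp
  rw [this, fderiv_fun_mul hh (hXi i)]
  simp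

end Divergence

/-- Pointwise coercivity estimate: `v = (u - γ)₊`, `ψ` the cut-off, `y = |X|`, `g = |∇u|`. -/
theorem cutoff_coercive_pointwise {A δ σ α p Λ T R v ψ y g D I J : ℝ}
    (hA : 0 < A) (hδ : 0 < δ) (hσ : δ < σ) (hα : 1 < α) (hΛ : 0 < Λ) (hT : 0 < T) (hR : 0 < R)
    (hp : p = (1 + δ) / (σ - δ))
    (hTeq : T ^ (σ - δ) = 2 * (A * α * (2 * (p * (α + σ)) / (α * R)) ^ (1 + δ)) / Λ)
    (hv : 0 < v) (hψ : 0 < ψ) (hy : 0 ≤ y) (hg : 0 ≤ g) (hyg : y ≤ A * g ^ δ)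
    (hD : Λ * v ^ σ ≤ D) (hI : I = y * g) (hJ : -(2 / R * y) ≤ J) :
    Λ * (1 / 2 * (v * ψ ^ p) ^ (α + σ) - T ^ (α + σ)) ≤
      v ^ α * ψ ^ (p * (α + σ)) * D + (α * v ^ (α - 1) * ψ ^ (p * (α + σ)) * I
        + v ^ α * (p * (α + σ) * ψ ^ (p * (α + σ) - 1)) * J) := by
  have hσδ : 0 < σ - δ := by linarith
  have hp0 : 0 < p := by rw [hp]; positivity
  have hpσ : p * (σ - δ) = 1 + δ := by rw [hp]; field_simp
  set k := p * (α + σ) with hk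
  have hασ : 0 < α + σ := by linarith
  have hk0 : 0 < k := by positivity
  have hα0 : 0 < α := by linarith
  set M := A * α * (2 * k / (α * R)) ^ (1 + δ) with hM
  have hM0 : 0 < M := by positivity
  -- absorption of the cut-off gradient term
  have hgrad : -(M * v ^ (α + δ) * ψ ^ (k - (1 + δ))) ≤
      α * v ^ (α - 1) * ψ ^ k * I + v ^ α * (k * ψ ^ (k - 1)) * J := by
    have hv1 : v ^ α = v ^ (α - 1) * v := by
      rw [← Real.rpow_add_one hv.ne']; ring_nf
    have hψ1' : ψ ^ k = ψ ^ (k - 1) * ψ := by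
      rw [← Real.rpow_add_one hψ.ne']; ring_nf
    set P := v ^ (α - 1) * ψ ^ (k - 1) with hP
    have hP0 : 0 < P := by positivity
    have e1 : α * v ^ (α - 1) * ψ ^ k * I + v ^ α * (k * ψ ^ (k - 1)) * J
        = P * (α * ψ * (y * g) + v * k * J) := by
      rw [hv1, hψ1', hI, hP]; ring
    have hJ' : v * k * -(2 / R * y) ≤ v * k * J :=
      mul_le_mul_of_nonneg_left hJ (by positivity)
    set B := 2 * k / (α * R) * (v / ψ) with hB
    have hB0 : 0 < B := by positivity
    have e2 : v * k * -(2 / R * y) = -(α * ψ * B * y) := by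
      rw [hB]; field_simp
    have hBpow : M * v ^ (α + δ) * ψ ^ (k - (1 + δ)) = P * (α * ψ * (A * B ^ (1 + δ))) := by
      rw [hB, Real.mul_rpow (by positivity) (by positivity), Real.div_rpow hv.le hψ.le, hM, hP]
      have a1 : v ^ (α + δ) = v ^ (α - 1) * v ^ (1 + δ) := by
        rw [← Real.rpow_add hv]; ring_nf
      have a2 : ψ ^ (k - (1 + δ)) = ψ ^ (k - 1) * ψ / ψ ^ (1 + δ) := by
        rw [Real.rpow_sub hψ, hψ1']
      rw [a1, a2]; ring
    rw [e1, hBpow, ← mul_neg]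
    refine mul_le_mul_of_nonneg_left ?_ hP0.le
    have hcore : -(A * B ^ (1 + δ)) ≤ y * g - B * y := by
      by_cases hc : B ≤ g
      · have : 0 ≤ y * (g - B) := mul_nonneg hy (by linarith)
        have : 0 < A * B ^ (1 + δ) := by positivity
        linarith
      · push Not at hc
        have h1 : y ≤ A * B ^ δ :=
          hyg.trans (mul_le_mul_of_nonneg_left (Real.rpow_le_rpow hg hc.le hδ.le) hA.le)
        have h2 : B ^ (1 + δ) = B * B ^ δ := by rw [Real.rpow_add hB0, Real.rpow_one]
        have h3 : B * y ≤ B * (A * B ^ δ) := mul_le_mul_of_nonneg_left h1 hB0.le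
        have h4 : 0 ≤ y * g := mul_nonneg hy hg
        rw [h2]; linarith
    have := mul_le_mul_of_nonneg_left hcore (mul_pos hα0 hψ).le
    linarith
  have hDterm : Λ * v ^ (α + σ) * ψ ^ k ≤ v ^ α * ψ ^ k * D := by
    have := mul_le_mul_of_nonneg_left hD (show 0 ≤ v ^ α * ψ ^ k by positivity)
    rw [Real.rpow_add hv]; linarith
  have hZ : (v * ψ ^ p) ^ (α + σ) = v ^ (α + σ) * ψ ^ k := by
    rw [Real.mul_rpow hv.le (by positivity), ← Real.rpow_mul hψ.le]
  have hT0 : 0 < T ^ (α + σ) := by positivity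
  have hfin : Λ * (1 / 2 * (v ^ (α + σ) * ψ ^ k) - T ^ (α + σ)) ≤
      Λ * v ^ (α + σ) * ψ ^ k - M * v ^ (α + δ) * ψ ^ (k - (1 + δ)) := by
    have hMT : M = Λ / 2 * T ^ (σ - δ) := by rw [hTeq]; field_simp
    have hψk : ψ ^ (k - (1 + δ)) = ψ ^ (p * (α + δ)) := by
      congr 1; rw [hk, ← hpσ]; ring
    have hψk' : ψ ^ k = ψ ^ (p * (α + δ)) * ψ ^ (p * (σ - δ)) := by
      rw [← Real.rpow_add hψ]; congr 1; rw [hk]; ring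
    have hvs : v ^ (α + σ) = v ^ (α + δ) * v ^ (σ - δ) := by
      rw [← Real.rpow_add hv]; ring_nf
    have hTs : T ^ (α + σ) = T ^ (α + δ) * T ^ (σ - δ) := by
      rw [← Real.rpow_add hT]; ring_nf
    have c1 : v ^ (α + δ) * ψ ^ (p * (α + δ)) = (v * ψ ^ p) ^ (α + δ) := by
      rw [Real.mul_rpow hv.le (by positivity), ← Real.rpow_mul hψ.le]
    have c2 : v ^ (σ - δ) * ψ ^ (p * (σ - δ)) = (v * ψ ^ p) ^ (σ - δ) := by
      rw [Real.mul_rpow hv.le (by positivity), ← Real.rpow_mul hψ.le]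
    have d1 : v ^ (α + σ) * ψ ^ k = (v * ψ ^ p) ^ (α + δ) * (v * ψ ^ p) ^ (σ - δ) := by
      rw [← c1, ← c2, hvs, hψk']; ring
    have d2 : M * v ^ (α + δ) * ψ ^ (k - (1 + δ))
        = Λ / 2 * T ^ (σ - δ) * (v * ψ ^ p) ^ (α + δ) := by
      rw [hMT, hψk, ← c1]; ring
    rw [mul_assoc Λ, d1, d2, hTs]
    have hz : 0 < v * ψ ^ p := by positivity
    set z := v * ψ ^ p
    have hzz : 0 < z ^ (σ - δ) := by positivity
    have hzz' : 0 < z ^ (α + δ) := by positivity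
    have hTT : 0 < T ^ (σ - δ) := by positivity
    have hTT' : 0 < T ^ (α + δ) := by positivity
    rcases le_total T z with h | h
    · have h1 : T ^ (σ - δ) ≤ z ^ (σ - δ) := Real.rpow_le_rpow hT.le h hσδ.le
      have h2 := mul_le_mul_of_nonneg_left h1 (mul_pos hΛ hzz').le
      have h3 : 0 < Λ * (T ^ (α + δ) * T ^ (σ - δ)) := by positivity
      linarith
    · have h1 : z ^ (α + δ) ≤ T ^ (α + δ) := Real.rpow_le_rpow hz.le h (by linarith)
      have h2 := mul_le_mul_of_nonneg_left h1 (mul_pos hΛ hTT).le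
      have h3 : 0 < Λ * (z ^ (α + δ) * z ^ (σ - δ)) := by positivity
      have h4 : 0 < Λ * (T ^ (α + δ) * T ^ (σ - δ)) := by positivity
      linarith
  rw [hZ]
  linarith

/-- Integral estimate obtained by testing the differential inequality
`Λ (u - γ)₊ ^ σ ≤ div X` on a ball of radius `R` against a power of the cut-off function. -/
theorem rpow_mul_volume_le_of_le_euclideanDiv {m : ℕ} {A δ σ α p Λ T R γ L : ℝ}
    {u : EuclideanSpace ℝ (Fin m) → ℝ}
    {X : EuclideanSpace ℝ (Fin m) → EuclideanSpace ℝ (Fin m)}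
    {U : Set (EuclideanSpace ℝ (Fin m))}
    (hA : 0 < A) (hδ : 0 < δ) (hσ : δ < σ) (hα : 1 < α) (hΛ : 0 < Λ) (hT : 0 < T) (hR : 0 < R)
    (hp : p = (1 + δ) / (σ - δ)) (hk : 1 < p * (α + σ))
    (hTeq : T ^ (σ - δ) = 2 * (A * α * (2 * (p * (α + σ)) / (α * R)) ^ (1 + δ)) / Λ)
    (hu : ContDiff ℝ 1 u) (hX : ContDiff ℝ 1 X)
    (hXu : ∀ x, fderiv ℝ u x (X x) = ‖X x‖ * ‖gradient u x‖)
    (hXA : ∀ x, ‖X x‖ ≤ A * ‖gradient u x‖ ^ δ)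
    (hdiv : ∀ x, ‖x‖ < R → γ < u x → Λ * (u x - γ) ^ σ ≤ euclideanDiv X x)
    (hU : MeasurableSet U) (hUR : ∀ x ∈ U, ‖x‖ < R) (hUγ : ∀ x ∈ U, γ < u x) (hL : 0 ≤ L)
    (hUL : ∀ x ∈ U, L ≤ (u x - γ) * (1 - (R ^ 2)⁻¹ * ‖x‖ ^ 2) ^ p) :
    L ^ (α + σ) * volume.real U ≤
      2 * T ^ (α + σ) * volume.real (Metric.ball (0 : EuclideanSpace ℝ (Fin m)) R) := by
  have hσ0 : 0 < σ := hδ.trans hσ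
  set k := p * (α + σ) with hkdef
  set f : EuclideanSpace ℝ (Fin m) → ℝ := fun y => max (u y - γ) 0 ^ α with hf
  set ψ : EuclideanSpace ℝ (Fin m) → ℝ := fun y => 1 - (R ^ 2)⁻¹ * ‖y‖ ^ 2 with hψ
  set g : EuclideanSpace ℝ (Fin m) → ℝ := fun y => max (ψ y) 0 ^ k with hg
  have hψC : ContDiff ℝ 1 ψ := contDiff_const.sub (contDiff_const.mul (contDiff_norm_sq ℝ))
  have hfC : ContDiff ℝ 1 f := (contDiff_max_zero_rpow hα).comp (hu.sub contDiff_const)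
  have hgC : ContDiff ℝ 1 g := (contDiff_max_zero_rpow hk).comp hψC
  have hψ_pos : ∀ x : EuclideanSpace ℝ (Fin m), ‖x‖ < R → 0 < ψ x := by
    intro x hx
    have h1 : ‖x‖ ^ 2 < R ^ 2 := by gcongr
    have h2 : (R ^ 2)⁻¹ * ‖x‖ ^ 2 < 1 := by
      rw [inv_mul_lt_iff₀ (by positivity), mul_one]; exact h1
    simp only [hψ]; linarith
  have hψ_neg : ∀ x : EuclideanSpace ℝ (Fin m), R ≤ ‖x‖ → ψ x ≤ 0 := by
    intro x hx
    have h1 : R ^ 2 ≤ ‖x‖ ^ 2 := by gcongr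
    have h2 : 1 ≤ (R ^ 2)⁻¹ * ‖x‖ ^ 2 := by
      rw [le_inv_mul_iff₀ (by positivity), mul_one]; exact h1
    simp only [hψ]; linarith
  set W : EuclideanSpace ℝ (Fin m) → EuclideanSpace ℝ (Fin m) :=
    fun y => (f y * g y) • X y with hW
  have hWC : ContDiff ℝ 1 W := (hfC.mul hgC).smul hX
  have hWc : HasCompactSupport W := by
    refine HasCompactSupport.intro
      (isCompact_closedBall (0 : EuclideanSpace ℝ (Fin m)) R) fun x hx => ?_
    have hx' : R ≤ ‖x‖ := by
      simp only [Metric.mem_closedBall, dist_zero_right, not_le] at hx; exact hx.le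
    have : g x = 0 := by
      simp only [hg, max_eq_right (hψ_neg x hx')]
      exact Real.zero_rpow (by linarith)
    simp [hW, this]
  have hdivW : ∀ x, euclideanDiv W x = f x * g x * euclideanDiv X x +
      (α * max (u x - γ) 0 ^ (α - 1) * g x * (‖X x‖ * ‖gradient u x‖)
        + f x * (k * max (ψ x) 0 ^ (k - 1)) * (-((R ^ 2)⁻¹ * (2 * inner ℝ x (X x))))) := by
    intro x
    have hux : HasFDerivAt (fun y => u y - γ) (fderiv ℝ u x) x :=
      ((hu.differentiable one_ne_zero) x).hasFDerivAt.sub_const γ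
    have h1 : HasFDerivAt f ((α * max (u x - γ) 0 ^ (α - 1)) • fderiv ℝ u x) x :=
      HasDerivAt.comp_hasFDerivAt (f := fun y => u y - γ) x
        (hasDerivAt_max_zero_rpow hα (u x - γ)) hux
    have h2 := ((hasStrictFDerivAt_norm_sq x).hasFDerivAt.const_mul (R ^ 2)⁻¹).const_sub 1
    have h3 := HasDerivAt.comp_hasFDerivAt (f := ψ) x (hasDerivAt_max_zero_rpow hk (ψ x)) h2
    change HasFDerivAt g _ x at h3
    rw [hW, euclideanDiv_smul (h1.fun_mul h3).differentiableAt ((hX.differentiable one_ne_zero) x),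
      (h1.fun_mul h3).fderiv]
    simp only [add_apply, smul_apply,
      neg_apply, smul_eq_mul, hXu, innerSL_apply_apply, nsmul_eq_mul]
    push_cast
    ring
  have hpt : ∀ x, U.indicator (fun _ => Λ * (1 / 2 * L ^ (α + σ))) x
      - (Metric.ball (0 : EuclideanSpace ℝ (Fin m)) R).indicator
          (fun _ => Λ * T ^ (α + σ)) x ≤ euclideanDiv W x := by
    intro x
    rw [hdivW]
    have hTp : 0 < Λ * T ^ (α + σ) := by positivity
    by_cases hxR : ‖x‖ < R
    · have hb : x ∈ Metric.ball (0 : EuclideanSpace ℝ (Fin m)) R := by simpa using hxR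
      rw [Set.indicator_of_mem hb]
      have hψx := hψ_pos x hxR
      by_cases hxγ : γ < u x
      · have hv : 0 < u x - γ := by linarith
        have hJ : -(2 / R * ‖X x‖) ≤ -((R ^ 2)⁻¹ * (2 * inner ℝ x (X x))) := by
          have h1 : inner ℝ x (X x) ≤ R * ‖X x‖ :=
            (real_inner_le_norm x (X x)).trans (by gcongr)
          have h2 : (R ^ 2)⁻¹ * (2 * inner ℝ x (X x)) ≤ (R ^ 2)⁻¹ * (2 * (R * ‖X x‖)) := by
            gcongr
          have h3 : (R ^ 2)⁻¹ * (2 * (R * ‖X x‖)) = 2 / R * ‖X x‖ := by field_simp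
          linarith
        have key := cutoff_coercive_pointwise hA hδ hσ hα hΛ hT hR hp hTeq hv hψx
          (norm_nonneg (X x)) (norm_nonneg (gradient u x)) (hXA x) (hdiv x hxR hxγ) rfl hJ
        simp only [hf, hg, max_eq_left hv.le, max_eq_left hψx.le]
        refine le_trans ?_ key
        have hZ : U.indicator (fun _ => Λ * (1 / 2 * L ^ (α + σ))) x
            ≤ Λ * (1 / 2 * ((u x - γ) * ψ x ^ p) ^ (α + σ)) := by
          refine Set.indicator_le' (fun y hy => ?_) (fun y hy => ?_) x
            (g := fun y => Λ * (1 / 2 * (max (u y - γ) 0 * (max (ψ y) 0) ^ p) ^ (α + σ))) |>.trans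
              (le_of_eq ?_)
          · have := hUL y hy
            have e1 := (hψ_pos y (hUR y hy)).le
            have e2 : 0 ≤ u y - γ := by linarith [hUγ y hy]
            simp only [max_eq_left e1, max_eq_left e2]
            gcongr
          · positivity
          · simp only [max_eq_left hv.le, max_eq_left hψx.le]
        linarith
      · have hxU : x ∉ U := fun h => hxγ (hUγ x h)
        have h0 : max (u x - γ) 0 = 0 := max_eq_right (by linarith)
        have h1 : (0 : ℝ) ^ α = 0 := Real.zero_rpow (by linarith)
        have h2 : (0 : ℝ) ^ (α - 1) = 0 := Real.zero_rpow (by linarith)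
        rw [Set.indicator_of_notMem hxU]
        simp only [hf, h0, h1, h2]
        simp only [mul_zero, zero_mul, add_zero]
        linarith
    · have hb : x ∉ Metric.ball (0 : EuclideanSpace ℝ (Fin m)) R := by simpa using hxR
      have hxU : x ∉ U := fun h => hxR (hUR x h)
      have h0 : max (ψ x) 0 = 0 := max_eq_right (hψ_neg x (not_lt.mp hxR))
      have h1 : (0 : ℝ) ^ k = 0 := Real.zero_rpow (by linarith)
      have h2 : (0 : ℝ) ^ (k - 1) = 0 := Real.zero_rpow (by linarith)
      rw [Set.indicator_of_notMem hxU, Set.indicator_of_notMem hb]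
      simp only [hg, h0, h1, h2]
      simp
  have hbfin : volume (Metric.ball (0 : EuclideanSpace ℝ (Fin m)) R) ≠ ⊤ :=
    measure_ball_lt_top.ne
  have hUfin : volume U ≠ ⊤ :=
    measure_ne_top_of_subset (fun x hx => by simpa using hUR x hx) hbfin
  have hi1 : Integrable (U.indicator fun _ => Λ * (1 / 2 * L ^ (α + σ))) :=
    (integrable_indicator_iff hU).2 (integrableOn_const hUfin)
  have hi2 : Integrable ((Metric.ball (0 : EuclideanSpace ℝ (Fin m)) R).indicator
      fun _ => Λ * T ^ (α + σ)) :=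
    (integrable_indicator_iff measurableSet_ball).2 (integrableOn_const hbfin)
  have hint := integral_mono (hi1.sub hi2) (integrable_euclideanDiv hWC hWc) hpt
  rw [integral_euclideanDiv_eq_zero hWC hWc] at hint
  simp only [Pi.sub_apply] at hint
  rw [integral_sub hi1 hi2, integral_indicator_const _ hU,
    integral_indicator_const _ measurableSet_ball] at hint
  simp only [smul_eq_mul] at hint
  refine le_of_mul_le_mul_left ?_ hΛ
  linarith

set_option maxHeartbeats 400000 in
/-- A priori upper bound for subsolutions of `λ (u - γ)₊ ^ σ / Q ≤ div X`, with a constant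
independent of `γ` and `λ`. -/
theorem exists_sub_le_mul_rpow_of_le_euclideanDiv {m : ℕ} {A δ σ C : ℝ} {Q : ℝ → ℝ}
    {u : EuclideanSpace ℝ (Fin m) → ℝ}
    {X : EuclideanSpace ℝ (Fin m) → EuclideanSpace ℝ (Fin m)}
    (hA : 0 < A) (hδ : 0 < δ) (hσ : δ < σ)
    (hQpos : ∀ t > (0 : ℝ), 0 < Q t)
    (hQ : ∃ᶠ r in atTop, Q r * Real.log r / r ^ (1 + δ) ≤ C)
    (hu : ContDiff ℝ 1 u) (hX : ContDiff ℝ 1 X)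
    (hXu : ∀ x, fderiv ℝ u x (X x) = ‖X x‖ * ‖gradient u x‖)
    (hXA : ∀ x, ‖X x‖ ≤ A * ‖gradient u x‖ ^ δ) :
    ∃ C₀ : ℝ, 0 < C₀ ∧ ∀ γ lam : ℝ, 0 < lam →
      (∀ R > 0, ∀ x, ‖x‖ < R → γ < u x → lam / Q R * (u x - γ) ^ σ ≤ euclideanDiv X x) →
      ∀ x, u x - γ ≤ C₀ * (1 / lam) ^ (1 / (σ - δ)) := by
  have hσ0 : 0 < σ := hδ.trans hσ
  have hσδ : 0 < σ - δ := by linarith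
  obtain ⟨p, hp⟩ : ∃ p, p = (1 + δ) / (σ - δ) := ⟨_, rfl⟩
  have hp0 : 0 < p := by rw [hp]; positivity
  set C' := max C 1 with hC'
  have hC'0 : 0 < C' := lt_of_lt_of_le one_pos (le_max_right _ _)
  set K := 2 * A * (4 * p) ^ (1 + δ) * C' with hK
  have hK0 : 0 < K := by positivity
  set T₀ := K ^ (1 / (σ - δ)) with hT₀
  have hT₀0 : 0 < T₀ := by positivity
  refine ⟨2 ^ p * (2 * (Real.exp m * T₀)), by positivity, fun γ lam hlam hdiv x₀ => ?_⟩
  by_contra! hcon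
  set S := T₀ * (1 / lam) ^ (1 / (σ - δ)) with hS
  have hS0 : 0 < S := by positivity
  set L := 2 * (Real.exp m * S) with hL
  have hL0 : 0 < L := by positivity
  have hcon' : 2 ^ p * L < u x₀ - γ := by
    have : 2 ^ p * L = 2 ^ p * (2 * (Real.exp m * T₀)) * (1 / lam) ^ (1 / (σ - δ)) := by
      rw [hL, hS]; ring
    rw [this]; exact hcon
  set R₀ := ‖x₀‖ + 1 with hR₀
  have hR₀0 : 0 < R₀ := by positivity
  set U : Set (EuclideanSpace ℝ (Fin m)) := {x | 2 ^ p * L < u x - γ} ∩ Metric.ball 0 R₀ with hU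
  have hUo : IsOpen U :=
    (isOpen_lt continuous_const (hu.continuous.sub continuous_const)).inter Metric.isOpen_ball
  have hUne : U.Nonempty := ⟨x₀, hcon', by simp [hR₀]⟩
  have hUfin : volume U ≠ ⊤ :=
    measure_ne_top_of_subset Set.inter_subset_right measure_ball_lt_top.ne
  have hμU : 0 < volume.real U :=
    ENNReal.toReal_pos (hUo.measure_pos volume hUne).ne' hUfin
  set ω := volume.real (Metric.ball (0 : EuclideanSpace ℝ (Fin m)) 1) with hω
  have hlog : Tendsto Real.log atTop atTop := Real.tendsto_log_atTop
  have hlim : Tendsto (fun r : ℝ => (2 : ℝ) ^ Real.log r * volume.real U) atTop atTop :=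
    ((tendsto_rpow_atTop_of_base_gt_one 2 one_lt_two).comp hlog).atTop_mul_const hμU
  obtain ⟨R, hRQ, hR1, hRσ, hRσ1, hRp, hR2⟩ :=
    (hQ.and_eventually ((eventually_ge_atTop (2 * R₀)).and
      ((hlog.eventually_ge_atTop (2 * σ)).and ((hlog.eventually_gt_atTop (1 + σ)).and
        ((hlog.eventually_gt_atTop (1 / p)).and (hlim.eventually_gt_atTop (2 * ω))))))).exists
  have hR0 : 0 < R := by linarith
  have hQR : 0 < Q R := hQpos R hR0
  obtain ⟨β, hβ⟩ : ∃ β, β = Real.log R := ⟨_, rfl⟩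
  rw [← hβ] at hRQ hRσ hRσ1 hRp hR2
  obtain ⟨α, hαβ⟩ : ∃ α, α = β - σ := ⟨_, rfl⟩
  have hsum : α + σ = β := by linarith
  have hα1 : 1 < α := by linarith
  have hα0 : 0 < α := by linarith
  have hβ0 : 0 < β := by linarith
  have hpβ : 1 < p * (α + σ) := by
    rw [hsum, mul_comm]; exact (div_lt_iff₀ hp0).1 hRp
  set N := 2 * (A * α * (2 * (p * (α + σ)) / (α * R)) ^ (1 + δ)) / (lam / Q R) with hN
  have hN0 : 0 < N := by positivity
  have hNK : N ≤ K * (1 / lam) := by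
    have h1 : 2 * (p * (α + σ)) / (α * R) ≤ 4 * p / R := by
      rw [hsum, div_le_div_iff₀ (by positivity) hR0]
      have : β ≤ 2 * α := by linarith
      nlinarith [mul_le_mul_of_nonneg_left this (mul_pos hp0 hR0).le]
    have h2 : (2 * (p * (α + σ)) / (α * R)) ^ (1 + δ) ≤ (4 * p) ^ (1 + δ) / R ^ (1 + δ) := by
      rw [← Real.div_rpow (by positivity) hR0.le]
      exact Real.rpow_le_rpow (by positivity) h1 (by linarith)
    have h3 : Q R * β / R ^ (1 + δ) ≤ C' := hRQ.trans (le_max_left _ _)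
    calc N ≤ 2 * (A * β * ((4 * p) ^ (1 + δ) / R ^ (1 + δ))) / (lam / Q R) := by
          rw [hN]; gcongr; linarith
      _ = 2 * A * (4 * p) ^ (1 + δ) * (Q R * β / R ^ (1 + δ)) * (1 / lam) := by
          field_simp
      _ ≤ K * (1 / lam) := by rw [hK]; gcongr
  set T := N ^ (1 / (σ - δ)) with hT
  have hT0 : 0 < T := by positivity
  have hTS : T ≤ S := by
    rw [hS, hT₀, ← Real.mul_rpow hK0.le (by positivity)]
    exact Real.rpow_le_rpow hN0.le hNK (by positivity)
  have hTeq : T ^ (σ - δ) = N := by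
    rw [hT, ← Real.rpow_mul hN0.le, one_div_mul_cancel hσδ.ne', Real.rpow_one]
  have hUL : ∀ x ∈ U, L ≤ (u x - γ) * (1 - (R ^ 2)⁻¹ * ‖x‖ ^ 2) ^ p := by
    rintro x ⟨hx, hxR⟩
    have hxR' : ‖x‖ < R₀ := by simpa using hxR
    have h1 : (R ^ 2)⁻¹ * ‖x‖ ^ 2 ≤ 1 / 2 := by
      rw [inv_mul_le_iff₀ (by positivity)]
      nlinarith [norm_nonneg x]
    have h2 : (1 / 2 : ℝ) ^ p ≤ (1 - (R ^ 2)⁻¹ * ‖x‖ ^ 2) ^ p :=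
      Real.rpow_le_rpow (by norm_num) (by linarith) hp0.le
    have h3 : (2 : ℝ) ^ p * (1 / 2) ^ p = 1 := by
      rw [← Real.mul_rpow (by norm_num) (by norm_num)]; norm_num
    have hx' : 2 ^ p * L < u x - γ := hx
    have hx0 : 0 ≤ u x - γ := (by positivity : 0 ≤ 2 ^ p * L).trans hx'.le
    calc L = 2 ^ p * L * (1 / 2) ^ p := by linear_combination (-L) * h3
      _ ≤ (u x - γ) * (1 - (R ^ 2)⁻¹ * ‖x‖ ^ 2) ^ p := by gcongr
  have key := rpow_mul_volume_le_of_le_euclideanDiv hA hδ hσ hα1 (div_pos hlam hQR) hT0 hR0 hp hpβ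
    hTeq hu hX hXu hXA (hdiv R hR0) hUo.measurableSet
    (fun x hx => by
      have : ‖x‖ < R₀ := by simpa using hx.2
      linarith)
    (fun x hx => by
      have h1 : 2 ^ p * L < u x - γ := hx.1
      have h2 : 0 < 2 ^ p * L := by positivity
      linarith) hL0.le hUL
  have hvol : volume.real (Metric.ball (0 : EuclideanSpace ℝ (Fin m)) R)
      = Real.exp m ^ β * ω := by
    rw [hω, Measure.real, Measure.addHaar_ball_of_pos volume 0 hR0, ENNReal.toReal_mul,
      ENNReal.toReal_ofReal (by positivity), finrank_euclideanSpace_fin, ← Real.exp_mul,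
      mul_comm (m : ℝ) β, hβ, Real.exp_mul, Real.exp_log hR0, Real.rpow_natCast, Measure.real]
  rw [hsum, hvol] at key
  have hLβ : L ^ β = 2 ^ β * (Real.exp m ^ β * S ^ β) := by
    rw [hL, Real.mul_rpow (by norm_num) (by positivity), Real.mul_rpow (by positivity) hS0.le]
  have hω0 : 0 ≤ ω := measureReal_nonneg
  have hE0 : 0 < Real.exp m ^ β * S ^ β := by positivity
  have hfin : Real.exp m ^ β * S ^ β * (2 ^ β * volume.real U) ≤
      Real.exp m ^ β * S ^ β * (2 * ω) := by
    calc Real.exp m ^ β * S ^ β * (2 ^ β * volume.real U) = L ^ β * volume.real U := by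
          rw [hLβ]; ring
      _ ≤ 2 * T ^ β * (Real.exp m ^ β * ω) := key
      _ ≤ 2 * S ^ β * (Real.exp m ^ β * ω) := by gcongr
      _ = Real.exp m ^ β * S ^ β * (2 * ω) := by ring
  exact absurd (le_of_mul_le_mul_left hfin hE0) (not_le.2 hR2)

theorem stmt14 {m : ℕ} (hm : 2 ≤ m)
    (φ : ℝ → ℝ) (A δ : ℝ) (hA : 0 < A) (hδ : 0 < δ)
    (hφC0 : ContinuousOn φ (Set.Ici 0)) (hφC1 : ContDiffOn ℝ 1 φ (Set.Ioi 0))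
    (hφ0 : φ 0 = 0) (hφpos : ∀ t > (0:ℝ), 0 < φ t)
    (hφA : ∀ t ≥ (0:ℝ), φ t ≤ A * t ^ δ)
    (σ H : ℝ) (hσ : max 1 δ < σ) (hH : 0 < H)
    (Q : ℝ → ℝ)
    (hQpos : ∀ t > (0:ℝ), 0 < Q t)
    (hQmono : ∀ s t : ℝ, 0 < s → s ≤ t → Q s ≤ Q t)
    (hQo : Q =o[atTop] fun t => t ^ (1 + δ))
    (hliminf : ∃ C : ℝ, ∃ᶠ r in atTop, Q r * Real.log r / r ^ (1 + δ) ≤ C)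
    (a b : EuclideanSpace ℝ (Fin m) → ℝ) (ha : Continuous a) (hb : Continuous b)
    (hbQ : ∀ x : EuclideanSpace ℝ (Fin m), 0 < ‖x‖ → 1 / Q ‖x‖ ≤ b x)
    (haminus : ∃ C : ℝ, ∀ x, max (-a x) 0 ≤ C)
    (haH : ∀ x, max (-a x) 0 / b x ≤ H)
    (u : EuclideanSpace ℝ (Fin m) → ℝ) (hu : ContDiff ℝ 1 u)
    (hupos : ∀ x, 0 ≤ u x)
    (X : EuclideanSpace ℝ (Fin m) → EuclideanSpace ℝ (Fin m))
    (hXdef : ∀ x, X x = if gradient u x = 0 then 0 else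
      (φ ‖gradient u x‖ / ‖gradient u x‖) • gradient u x)
    (hXC1 : ContDiff ℝ 1 X)
    (hineq : ∀ x, b x * u x ^ σ + a x * u x ≤ euclideanDiv X x) :
    ∀ x, u x ≤ H ^ (1 / (σ - 1)) := by
  have hσ1 : 1 < σ := (le_max_left _ _).trans_lt hσ
  have hδσ : δ < σ := (le_max_right _ _).trans_lt hσ
  have hσ0 : 0 < σ := by linarith
  have hσ1' : 0 < σ - 1 := by linarith
  have hσδ : 0 < σ - δ := by linarith
  have hXnorm : ∀ x, ‖X x‖ = φ ‖gradient u x‖ := by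
    intro x
    rw [hXdef]
    split_ifs with h
    · simp [h, hφ0]
    · have hg : 0 < ‖gradient u x‖ := norm_pos_iff.2 h
      rw [norm_smul, Real.norm_of_nonneg (div_nonneg (hφpos _ hg).le hg.le)]
      field_simp
  have hXu : ∀ x, fderiv ℝ u x (X x) = ‖X x‖ * ‖gradient u x‖ := by
    intro x
    rw [hXnorm, hXdef]
    split_ifs with h
    · simp [h]
    · have hg : 0 < ‖gradient u x‖ := norm_pos_iff.2 h
      rw [← inner_gradient_left, real_inner_smul_right, real_inner_self_eq_norm_sq]
      field_simp
  have hXA : ∀ x, ‖X x‖ ≤ A * ‖gradient u x‖ ^ δ := fun x =>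
    (hXnorm x).le.trans (hφA _ (norm_nonneg _))
  obtain ⟨C, hQC⟩ := hliminf
  have hbR : ∀ R > 0, ∀ x, ‖x‖ < R → 1 / Q R ≤ b x := by
    intro R hR x hx
    have hne : ∀ y : EuclideanSpace ℝ (Fin m), y ≠ 0 → ‖y‖ < R → 1 / Q R ≤ b y := by
      intro y hy hyR
      have hy0 : 0 < ‖y‖ := norm_pos_iff.2 hy
      exact (one_div_le_one_div_of_le (hQpos _ hy0) (hQmono _ _ hy0 hyR.le)).trans (hbQ y hy0)
    by_cases hx0 : x = 0
    · subst hx0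
      have : Nontrivial (Fin m) := Fin.nontrivial_iff_two_le.2 hm
      refine ge_of_tendsto ((hb.tendsto 0).mono_left (nhdsWithin_le_nhds (s := {0}ᶜ))) ?_
      filter_upwards [self_mem_nhdsWithin,
        nhdsWithin_le_nhds (Metric.ball_mem_nhds (0 : EuclideanSpace ℝ (Fin m)) hR)] with y hy hyR
      exact hne y hy (by simpa using hyR)
    · exact hne x hx0 hx
  have hbpos : ∀ x, 0 < b x := fun x =>
    (one_div_pos.2 (hQpos (‖x‖ + 1) (by positivity))).trans_le
      (hbR (‖x‖ + 1) (by positivity) x (by linarith))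
  obtain ⟨C₀, hC₀, hC₀u⟩ :=
    exists_sub_le_mul_rpow_of_le_euclideanDiv hA hδ hδσ hQpos hQC hu hXC1 hXu hXA
  intro x₁
  by_contra! hx₁
  obtain ⟨γ₁, hγ₁, hγ₁u⟩ := exists_between hx₁
  have hγ₁0 : 0 < γ₁ := (Real.rpow_pos_of_pos hH _).trans hγ₁
  set s := γ₁ ^ (σ - 1) with hs
  have hs0 : 0 < s := by positivity
  have hHs : H < s := by
    have := Real.rpow_lt_rpow (by positivity) hγ₁ hσ1'
    rwa [← Real.rpow_mul hH.le, one_div_mul_cancel hσ1'.ne', Real.rpow_one] at this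
  obtain ⟨c, hc⟩ : ∃ c, c = 1 - H / s := ⟨_, rfl⟩
  have hc0 : 0 < c := by
    have : H / s < 1 := (div_lt_one hs0).2 hHs
    linarith
  have hcs : (1 - c) * s = H := by rw [hc]; field_simp; ring
  have hc1 : 0 ≤ 1 - c := by
    have : 0 < H / s := by positivity
    linarith
  have hmain : ∀ x, γ₁ < u x → c * (b x * u x ^ σ) ≤ euclideanDiv X x := by
    intro x hx
    have hux : 0 < u x := hγ₁0.trans hx
    have h1 : s ≤ u x ^ (σ - 1) := Real.rpow_le_rpow hγ₁0.le hx.le hσ1'.le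
    have h2 : H ≤ (1 - c) * u x ^ (σ - 1) := by
      rw [← hcs]; exact mul_le_mul_of_nonneg_left h1 hc1
    have h3 : -a x ≤ H * b x :=
      (le_max_left _ _).trans ((div_le_iff₀ (hbpos x)).1 (haH x))
    have h4 : u x ^ σ = u x ^ (σ - 1) * u x := by
      rw [← Real.rpow_add_one hux.ne']; ring_nf
    have h5 : -a x * u x ≤ (1 - c) * u x ^ (σ - 1) * b x * u x :=
      mul_le_mul_of_nonneg_right
        (h3.trans (mul_le_mul_of_nonneg_right h2 (hbpos x).le)) hux.le
    have h6 := hineq x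
    rw [h4] at h6 ⊢
    linarith
  have hdiv : ∀ γ lam : ℝ, γ₁ ≤ γ → (∀ x, γ < u x → lam * (u x - γ) ^ σ ≤ c * u x ^ σ) →
      ∀ R > 0, ∀ x, ‖x‖ < R → γ < u x → lam / Q R * (u x - γ) ^ σ ≤ euclideanDiv X x := by
    intro γ lam hγ hlam R hR x hxR hx
    have h0 : 0 < u x := hγ₁0.trans (hγ.trans_lt hx)
    have h1 := hlam x hx
    have h2 : 0 < 1 / Q R := one_div_pos.2 (hQpos R hR)
    calc lam / Q R * (u x - γ) ^ σ = 1 / Q R * (lam * (u x - γ) ^ σ) := by ring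
      _ ≤ 1 / Q R * (c * u x ^ σ) := by gcongr
      _ ≤ b x * (c * u x ^ σ) := by
          have := hbR R hR x hxR
          gcongr
      _ = c * (b x * u x ^ σ) := by ring
      _ ≤ euclideanDiv X x := hmain x (hγ.trans_lt hx)
  have hbdd : BddAbove (Set.range u) := by
    refine ⟨γ₁ + C₀ * (1 / c) ^ (1 / (σ - δ)), ?_⟩
    rintro _ ⟨x, rfl⟩
    have := hC₀u γ₁ c hc0 (hdiv γ₁ c le_rfl fun x hx => by
      have h1 : 0 ≤ u x - γ₁ := by linarith
      have h2 : u x - γ₁ ≤ u x := by linarith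
      gcongr) x
    linarith
  set M := ⨆ x, u x with hM
  have huM : ∀ x, u x ≤ M := fun x => le_ciSup hbdd x
  have hγ₁M : γ₁ < M := hγ₁u.trans_le (huM x₁)
  obtain ⟨D, hD⟩ : ∃ D, D = C₀ ^ (σ - δ) / (c * γ₁ ^ σ) := ⟨_, rfl⟩
  have hD0 : 0 < D := by rw [hD]; positivity
  obtain ⟨η, hη⟩ : ∃ η, η = min (M - γ₁) ((1 / (2 * D)) ^ (1 / δ)) := ⟨_, rfl⟩
  have hη0 : 0 < η := by rw [hη]; exact lt_min (by linarith) (by positivity)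
  have hηM : η ≤ M - γ₁ := hη ▸ min_le_left _ _
  have hηD : η ^ δ ≤ 1 / (2 * D) := by
    have h1 : η ≤ (1 / (2 * D)) ^ (1 / δ) := hη ▸ min_le_right _ _
    have h2 := Real.rpow_le_rpow hη0.le h1 hδ.le
    rwa [← Real.rpow_mul (by positivity), one_div_mul_cancel hδ.ne', Real.rpow_one] at h2
  obtain ⟨lam, hlam⟩ : ∃ lam, lam = c * (γ₁ / η) ^ σ := ⟨_, rfl⟩
  have hlam0 : 0 < lam := by rw [hlam]; positivity
  have hstep : ∀ x, u x - (M - η) ≤ C₀ * (1 / lam) ^ (1 / (σ - δ)) := by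
    refine hC₀u (M - η) lam hlam0 (hdiv (M - η) lam (by linarith) fun x hx => ?_)
    have h1 : 0 ≤ u x - (M - η) := by linarith
    have h2 : γ₁ / η * (u x - (M - η)) ≤ u x := by
      have h3 : u x - (M - η) ≤ η := by linarith [huM x]
      calc γ₁ / η * (u x - (M - η)) ≤ γ₁ / η * η := by gcongr
        _ = γ₁ := by field_simp
        _ ≤ u x := by linarith
    rw [hlam, mul_assoc, ← Real.mul_rpow (by positivity) h1]
    gcongr
  have hηle : η ≤ C₀ * (1 / lam) ^ (1 / (σ - δ)) := by
    have : M ≤ (M - η) + C₀ * (1 / lam) ^ (1 / (σ - δ)) :=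
      ciSup_le fun x => by linarith [hstep x]
    linarith
  have hpow : η ^ (σ - δ) ≤ C₀ ^ (σ - δ) * (1 / lam) := by
    have h := Real.rpow_le_rpow hη0.le hηle hσδ.le
    rwa [Real.mul_rpow hC₀.le (by positivity), ← Real.rpow_mul (by positivity),
      one_div_mul_cancel hσδ.ne', Real.rpow_one] at h
  have hησ : C₀ ^ (σ - δ) * (1 / lam) = η ^ (σ - δ) * (D * η ^ δ) := by
    have h1 : η ^ σ = η ^ (σ - δ) * η ^ δ := by rw [← Real.rpow_add hη0]; ring_nf
    rw [hlam, Real.div_rpow hγ₁0.le hη0.le, h1, hD]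
    field_simp
  rw [hησ] at hpow
  have hpos : 0 < η ^ (σ - δ) := by positivity
  have h1 : 1 ≤ D * η ^ δ := le_of_mul_le_mul_left (by simpa using hpow) hpos
  have h2 : D * η ^ δ ≤ D * (1 / (2 * D)) := by gcongr
  have h3 : D * (1 / (2 * D)) = 1 / 2 := by field_simp
  linarith
end
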